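/- Suppose that for some constants p ≥ 1, ε ∈ (0, 1/2), β > 1, and k ≥ 1, the following holds: for every sufficiently large integer n, there exists a lattice L_n ⊂ ℝ^{d_n} of rank n with d_n ≤ n^k, a target t_n ∈ ℝ^{d_n}, and a radius r_n > 0 such that N_p(L_n, (1−ε)^{1/p}·r_n, t_n) ≥ β^n · N_p(L_n, r_n, 0). Then for any constants C ≥ 1 and η ∈ (2ε², 1), there exist constants γ > 1 and C† > 0 such that for all sufficiently large integers m and d satisfying m/C ≤ d ≤ C·m, there exist distances r ≥ d^{1/p} and s > 0, a scaling factor α > 0, and a target t† ∈ ℝ^{d_{n†}} with n† := ⌈C†·m⌉, such that, setting L† := α·L_{n†} and r* := γ·(r^p + s^p)^{1/p}, one has N_p(ℤ^m, r*, 0) · (N_p(L†, r*, 0) + (r*/s) · D_p(L†, ((r*)^p − d)^{1/p})) < 2^{−m} · N_p(L†, (r^p − η·d)^{1/p}, t†). -/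

import Mathlib

open Real BigOperators

/-- The ℓ_p "norm" (for a real exponent `p`) of a vector in `ℝ^d`. -/
noncomputable def lpNorm (p : ℝ) {d : ℕ} (x : Fin d → ℝ) : ℝ :=
  (∑ i, |x i| ^ p) ^ (1 / p)

/-- The lattice generated by the vectors `B 0, …, B (n-1)`:
the set of all integer linear combinations of the `B i`. -/
def latticeOf {d n : ℕ} (B : Fin n → Fin d → ℝ) : Set (Fin d → ℝ) :=
  {y | ∃ c : Fin n → ℤ, y = ∑ i, c i • B i}

/-- The scaled lattice `α·L = {α y : y ∈ L}`. -/
def scaleSet {d : ℕ} (α : ℝ) (L : Set (Fin d → ℝ)) : Set (Fin d → ℝ) :=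
  (fun y => α • y) '' L

/-- `N_p(L, r, t)`: the number of lattice points `y ∈ L` with `‖y − t‖_p ≤ r`. -/
noncomputable def Ncount (p : ℝ) {d : ℕ} (L : Set (Fin d → ℝ)) (r : ℝ)
    (t : Fin d → ℝ) : ℕ :=
  Nat.card {y : Fin d → ℝ // y ∈ L ∧ lpNorm p (y - t) ≤ r}

/-- `D_p(L, r) := max_{t ∈ ℝ^d} N_p(L, r, t)`, the maximal density at radius `r`. -/
noncomputable def Dcount (p : ℝ) {d : ℕ} (L : Set (Fin d → ℝ)) (r : ℝ) : ℕ :=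
  ⨆ t : Fin d → ℝ, Ncount p L r t

/-- `N_p(ℤ^m, r, 0)`: the number of integer points `z ∈ ℤ^m` with `‖z‖_p ≤ r`. -/
noncomputable def NptZ (p : ℝ) (m : ℕ) (r : ℝ) : ℕ :=
  Nat.card {z : Fin m → ℤ | lpNorm p (fun i => (z i : ℝ)) ≤ r}


theorem lpNorm_add_le' {p : ℝ} (hp : 1 ≤ p) {d : ℕ} (x y : Fin d → ℝ) :
    lpNorm p (x + y) ≤ lpNorm p x + lpNorm p y := by
  unfold lpNorm
  exact Real.Lp_add_le Finset.univ x y hp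

theorem lpNorm_neg' {p : ℝ} {d : ℕ} (x : Fin d → ℝ) : lpNorm p (-x) = lpNorm p x := by
  simp [lpNorm]

theorem lpNorm_smul' {p : ℝ} (hp : 1 ≤ p) {d : ℕ} (a : ℝ) (ha : 0 < a) (x : Fin d → ℝ) :
    lpNorm p (a • x) = a * lpNorm p x := by
  unfold lpNorm
  have h1 : ∀ i, |(a • x) i| ^ p = a ^ p * |x i| ^ p := by
    intro i
    rw [Pi.smul_apply, smul_eq_mul, abs_mul, abs_of_pos ha,
      Real.mul_rpow ha.le (abs_nonneg _)]
  simp_rw [h1]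
  rw [← Finset.mul_sum, Real.mul_rpow (by positivity)
    (Finset.sum_nonneg fun i _ => by positivity), ← Real.rpow_mul ha.le,
    mul_one_div_cancel (by linarith), Real.rpow_one]

theorem abs_le_lpNorm {p : ℝ} (hp : 1 ≤ p) {d : ℕ} (x : Fin d → ℝ) (i : Fin d) :
    |x i| ≤ lpNorm p x := by
  unfold lpNorm
  have h : |x i| ^ p ≤ ∑ i, |x i| ^ p :=
    Finset.single_le_sum (f := fun i => |x i| ^ p) (fun i _ => by positivity) (Finset.mem_univ i)
  have h2 := Real.rpow_le_rpow (by positivity) h (z := 1 / p) (by positivity)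
  rwa [← Real.rpow_mul (abs_nonneg _), mul_one_div_cancel (by linarith), Real.rpow_one] at h2

theorem lattice_finite {p : ℝ} (hp : 1 ≤ p) {d n : ℕ} (B : Fin n → Fin d → ℝ)
    (hB : LinearIndependent ℝ B) (r : ℝ) (t : Fin d → ℝ) :
    {y | y ∈ latticeOf B ∧ lpNorm p (y - t) ≤ r}.Finite := by
  set f : (Fin n → ℝ) →ₗ[ℝ] (Fin d → ℝ) := Fintype.linearCombination ℝ B with hf
  have hinj : Function.Injective f := hB.fintypeLinearCombination_injective
  obtain ⟨κ, hκ, hanti⟩ := f.exists_antilipschitzWith (LinearMap.ker_eq_bot.mpr hinj)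
  have hfin : {c : Fin n → ℤ | ∀ i, c i ∈ Set.Icc (-⌈(κ : ℝ) * (r + ‖t‖)⌉) ⌈(κ : ℝ) * (r + ‖t‖)⌉}.Finite := by
    have := Set.Finite.pi (fun i : Fin n => Set.finite_Icc (-⌈(κ : ℝ) * (r + ‖t‖)⌉) ⌈(κ : ℝ) * (r + ‖t‖)⌉)
    refine this.subset ?_
    intro c hc i _
    exact hc i
  refine (hfin.image (fun c => ∑ i, c i • B i)).subset ?_
  rintro y ⟨⟨c, rfl⟩, hy⟩
  refine ⟨c, ?_, rfl⟩
  intro i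
  have hfc : f (fun i => (c i : ℝ)) = ∑ i, c i • B i := by
    rw [hf, Fintype.linearCombination_apply]
    exact Finset.sum_congr rfl fun i _ => Int.cast_smul_eq_zsmul ℝ (c i) (B i)
  have h0 := hanti.le_mul_dist (fun i => (c i : ℝ)) 0
  rw [map_zero, dist_zero_right, dist_zero_right, hfc] at h0
  set y := ∑ i, c i • B i
  have hr : 0 ≤ r := le_trans (by unfold lpNorm; exact Real.rpow_nonneg (Finset.sum_nonneg fun i _ => by positivity) _) hy
  have h1 : ‖y - t‖ ≤ r := by
    rw [pi_norm_le_iff_of_nonneg hr]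
    intro j
    exact (abs_le_lpNorm hp (y - t) j).trans hy
  have h2 : ‖y‖ ≤ r + ‖t‖ := by
    have := norm_add_le (y - t) t
    rw [sub_add_cancel] at this
    linarith
  have h3 : |(c i : ℝ)| ≤ κ * (r + ‖t‖) := by
    have := norm_le_pi_norm (fun i => (c i : ℝ)) i
    rw [Real.norm_eq_abs] at this
    have h4 : (κ : ℝ) * ‖y‖ ≤ κ * (r + ‖t‖) := by gcongr
    linarith
  have h5 := h3.trans (Int.le_ceil _)
  have h6 : |c i| ≤ ⌈(κ : ℝ) * (r + ‖t‖)⌉ := by exact_mod_cast h5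
  exact abs_le.mp h6

/-- The properties of a lattice that the argument uses. -/
structure GoodSet (p : ℝ) {d : ℕ} (G : Set (Fin d → ℝ)) : Prop where
  zero : (0 : Fin d → ℝ) ∈ G
  sub : ∀ x ∈ G, ∀ y ∈ G, x - y ∈ G
  fin : ∀ r t, {y | y ∈ G ∧ lpNorm p (y - t) ≤ r}.Finite

theorem goodSet_lattice {p : ℝ} (hp : 1 ≤ p) {d n : ℕ} (B : Fin n → Fin d → ℝ)
    (hB : LinearIndependent ℝ B) : GoodSet p (latticeOf B) where
  zero := ⟨0, by simp⟩
  sub := by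
    rintro x ⟨c, rfl⟩ y ⟨e, rfl⟩
    exact ⟨c - e, by simp [sub_smul, Finset.sum_sub_distrib]⟩
  fin := lattice_finite hp B hB

theorem scale_set_eq {p : ℝ} (hp : 1 ≤ p) {d : ℕ} (L : Set (Fin d → ℝ)) (a : ℝ) (ha : 0 < a)
    (r : ℝ) (t : Fin d → ℝ) :
    {y | y ∈ scaleSet a L ∧ lpNorm p (y - a • t) ≤ a * r} =
      (fun y => a • y) '' {y | y ∈ L ∧ lpNorm p (y - t) ≤ r} := by
  ext y
  constructor
  · rintro ⟨⟨x, hx, rfl⟩, h⟩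
    refine ⟨x, ⟨hx, ?_⟩, rfl⟩
    simp only at h
    rw [← smul_sub, lpNorm_smul' hp a ha] at h
    exact le_of_mul_le_mul_left h ha
  · rintro ⟨x, ⟨hx, h⟩, rfl⟩
    refine ⟨⟨x, hx, rfl⟩, ?_⟩
    simp only
    rw [← smul_sub, lpNorm_smul' hp a ha]
    gcongr

theorem goodSet_scale {p : ℝ} (hp : 1 ≤ p) {d : ℕ} {L : Set (Fin d → ℝ)} (hL : GoodSet p L)
    (a : ℝ) (ha : 0 < a) : GoodSet p (scaleSet a L) where
  zero := ⟨0, hL.zero, by simp⟩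
  sub := by
    rintro x ⟨c, hc, rfl⟩ y ⟨e, he, rfl⟩
    exact ⟨c - e, hL.sub c hc e he, by simp [smul_sub]⟩
  fin := by
    intro r t
    have := scale_set_eq hp L a ha (r / a) (a⁻¹ • t)
    rw [smul_inv_smul₀ ha.ne', mul_div_cancel₀ _ ha.ne'] at this
    rw [this]
    exact (hL.fin _ _).image _

theorem Ncount_eq_ncard (p : ℝ) {d : ℕ} (L : Set (Fin d → ℝ)) (r : ℝ) (t : Fin d → ℝ) :
    Ncount p L r t = {y | y ∈ L ∧ lpNorm p (y - t) ≤ r}.ncard := rfl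

theorem Ncount_scale {p : ℝ} (hp : 1 ≤ p) {d : ℕ} (L : Set (Fin d → ℝ)) (a : ℝ) (ha : 0 < a)
    (r : ℝ) (t : Fin d → ℝ) :
    Ncount p (scaleSet a L) (a * r) (a • t) = Ncount p L r t := by
  rw [Ncount_eq_ncard, Ncount_eq_ncard, scale_set_eq hp L a ha]
  exact Set.ncard_image_of_injective _ (smul_right_injective _ ha.ne')

theorem Ncount_mono {p : ℝ} {d : ℕ} {G : Set (Fin d → ℝ)} (hG : GoodSet p G) {r r' : ℝ}
    (h : r ≤ r') (t : Fin d → ℝ) : Ncount p G r t ≤ Ncount p G r' t := by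
  rw [Ncount_eq_ncard, Ncount_eq_ncard]
  exact Set.ncard_le_ncard (fun y hy => ⟨hy.1, hy.2.trans h⟩) (hG.fin _ _)

theorem Ncount_le_double {p : ℝ} (hp : 1 ≤ p) {d : ℕ} {G : Set (Fin d → ℝ)} (hG : GoodSet p G)
    (r : ℝ) (t : Fin d → ℝ) : Ncount p G r t ≤ Ncount p G (2 * r) 0 := by
  rw [Ncount_eq_ncard, Ncount_eq_ncard]
  rcases Set.eq_empty_or_nonempty {y | y ∈ G ∧ lpNorm p (y - t) ≤ r} with h | ⟨y0, h0, h0'⟩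
  · rw [h]; simp
  · refine Set.ncard_le_ncard_of_injOn (fun y => y - y0) ?_ ?_ (hG.fin _ _)
    · rintro y ⟨hy, hy'⟩
      refine ⟨hG.sub y hy y0 h0, ?_⟩
      have h1 := lpNorm_add_le' hp (y - t) (-(y0 - t))
      rw [lpNorm_neg'] at h1
      have h2 : y - t + -(y0 - t) = y - y0 - 0 := by abel
      rw [h2] at h1
      linarith
    · intro a _ b _ hab
      exact sub_left_injective hab

theorem Dcount_bdd {p : ℝ} (hp : 1 ≤ p) {d : ℕ} {G : Set (Fin d → ℝ)} (hG : GoodSet p G)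
    (r : ℝ) : BddAbove (Set.range fun t => Ncount p G r t) :=
  ⟨Ncount p G (2 * r) 0, by rintro _ ⟨t, rfl⟩; exact Ncount_le_double hp hG r t⟩

theorem Ncount_le_Dcount {p : ℝ} (hp : 1 ≤ p) {d : ℕ} {G : Set (Fin d → ℝ)} (hG : GoodSet p G)
    (r : ℝ) (t : Fin d → ℝ) : Ncount p G r t ≤ Dcount p G r :=
  le_ciSup (Dcount_bdd hp hG r) t

theorem Dcount_attained {p : ℝ} (hp : 1 ≤ p) {d : ℕ} {G : Set (Fin d → ℝ)} (hG : GoodSet p G)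
    (r : ℝ) : ∃ t, Ncount p G r t = Dcount p G r :=
  Nat.sSup_mem (Set.range_nonempty _) (Dcount_bdd hp hG r)

theorem Dcount_le_double {p : ℝ} (hp : 1 ≤ p) {d : ℕ} {G : Set (Fin d → ℝ)} (hG : GoodSet p G)
    (r : ℝ) : Dcount p G r ≤ Ncount p G (2 * r) 0 :=
  ciSup_le fun t => Ncount_le_double hp hG r t

theorem Dcount_mono {p : ℝ} (hp : 1 ≤ p) {d : ℕ} {G : Set (Fin d → ℝ)} (hG : GoodSet p G)
    {r r' : ℝ} (h : r ≤ r') : Dcount p G r ≤ Dcount p G r' :=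
  ciSup_le fun t => (Ncount_mono hG h t).trans (Ncount_le_Dcount hp hG r' t)

theorem one_le_Ncount {p : ℝ} (hp : 1 ≤ p) {d : ℕ} {G : Set (Fin d → ℝ)} (hG : GoodSet p G)
    {r : ℝ} (h : 0 ≤ r) : 1 ≤ Ncount p G r 0 := by
  rw [Ncount_eq_ncard, Nat.one_le_iff_ne_zero, ← Nat.pos_iff_ne_zero, Set.ncard_pos (hG.fin _ _)]
  refine ⟨0, hG.zero, ?_⟩
  have : lpNorm p (0 - 0 : Fin d → ℝ) = 0 := by
    unfold lpNorm
    simp [Real.zero_rpow (show p ≠ 0 by linarith), Real.zero_rpow (show p⁻¹ ≠ 0 by positivity)]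
  rw [this]; exact h

theorem jump_exists (q Y : ℝ) (hq : 1 ≤ q) (hY : 0 < Y) (J : ℕ) : ∀ X : ℕ → ℝ,
    q ^ (J + 1) * Y ≤ X 0 → X (J + 1) ≤ Y →
    ∃ j, j ≤ J ∧ q * X (j + 1) ≤ X j ∧ q * Y ≤ X j := by
  induction J with
  | zero =>
    intro X h0 h1
    refine ⟨0, le_rfl, ?_, ?_⟩
    · simp at h0 h1 ⊢
      nlinarith
    · simpa using h0
  | succ J ih =>
    intro X h0 h1
    by_cases h : q * X 1 ≤ X 0
    · refine ⟨0, by omega, h, le_trans ?_ h0⟩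
      gcongr
      exact le_self_pow₀ hq (by omega)
    · push Not at h
      obtain ⟨j, hj, h2, h3⟩ := ih (fun j => X (j + 1)) (by
        rw [pow_succ'] at h0
        have : q * (q ^ (J + 1) * Y) ≤ q * X 1 := by nlinarith
        exact le_of_mul_le_mul_left this (by linarith)) h1
      exact ⟨j + 1, by omega, h2, h3⟩

theorem NptZ_bound {p : ℝ} (hp : 1 ≤ p) (T : ℝ) : ∃ b : ℝ, 0 < b ∧
    ∀ (m : ℕ) (u : ℝ), 0 ≤ u → u ≤ T * m → (NptZ p m (u ^ (1 / p)) : ℝ) ≤ b ^ m := by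
  have hs : Summable (fun z : ℤ => ((1 : ℝ) / 2) ^ z.natAbs) := by
    apply Summable.of_nat_of_neg <;> simpa using summable_geometric_two
  set S := ∑' z : ℤ, ((1 : ℝ) / 2) ^ z.natAbs with hS
  have hSpos : 0 < S := hs.tsum_pos (fun i => by positivity) 0 (by positivity)
  refine ⟨2 ^ T * S, by positivity, ?_⟩
  intro m u hu huT
  have hp0 : 0 < p := by linarith
  -- every point satisfies the ℓ₁ bound
  have key : ∀ z : Fin m → ℤ, lpNorm p (fun i => (z i : ℝ)) ≤ u ^ (1 / p) →
      ((∑ i, (z i).natAbs : ℕ) : ℝ) ≤ T * m := by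
    intro z hz
    unfold lpNorm at hz
    rw [Real.rpow_le_rpow_iff (Finset.sum_nonneg fun i _ => by positivity) hu (by positivity)] at hz
    refine le_trans ?_ (hz.trans huT)
    push_cast
    apply Finset.sum_le_sum
    intro i _
    by_cases h0 : z i = 0
    · simp [h0, Real.zero_rpow hp0.ne']
    · have h1 : (1 : ℝ) ≤ |(z i : ℝ)| := by
        exact_mod_cast Int.one_le_abs h0
      have := Real.rpow_le_rpow_of_exponent_le h1 hp
      rw [Real.rpow_one] at this
      simpa [Nat.cast_natAbs] using this
  obtain ⟨M, hM⟩ := exists_nat_ge (T * m)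
  set Bx : Finset (Fin m → ℤ) := Fintype.piFinset (fun _ => Finset.Icc (-(M : ℤ)) M) with hBx
  classical
  set A : Finset (Fin m → ℤ) := Bx.filter (fun z => lpNorm p (fun i => (z i : ℝ)) ≤ u ^ (1 / p))
    with hA
  have hcard : NptZ p m (u ^ (1 / p)) = A.card := by
    unfold NptZ
    rw [← Set.ncard_coe_finset]
    change Set.ncard _ = _
    congr 1
    ext z
    simp only [hA, Set.mem_ofPred_eq, Finset.coe_filter, hBx, Fintype.mem_piFinset, Finset.mem_Icc]
    refine ⟨fun h => ⟨fun i => ?_, h⟩, fun h => h.2⟩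
    have h1 := (key z h).trans hM
    have h2 : ∑ i, (z i).natAbs ≤ M := by exact_mod_cast h1
    have h3 := Finset.single_le_sum (f := fun i => (z i).natAbs) (fun i _ => Nat.zero_le _) (Finset.mem_univ i)
    omega
  rw [hcard]
  have hw : ∀ z ∈ A, (1 : ℝ) ≤ 2 ^ (T * m) * ∏ i, ((1 : ℝ) / 2) ^ (z i).natAbs := by
    intro z hz
    have h1 := key z (Finset.mem_filter.mp hz).2
    rw [Finset.prod_pow_eq_pow_sum, one_div, inv_pow, ← div_eq_mul_inv, le_div_iff₀ (by positivity),
      one_mul, ← Real.rpow_natCast]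
    exact Real.rpow_le_rpow_of_exponent_le (by norm_num) h1
  calc (A.card : ℝ) = ∑ z ∈ A, (1 : ℝ) := by simp
    _ ≤ ∑ z ∈ A, 2 ^ (T * m) * ∏ i, ((1 : ℝ) / 2) ^ (z i).natAbs := Finset.sum_le_sum hw
    _ ≤ ∑ z ∈ Bx, 2 ^ (T * m) * ∏ i, ((1 : ℝ) / 2) ^ (z i).natAbs :=
        Finset.sum_le_sum_of_subset_of_nonneg (Finset.filter_subset _ _)
          (fun i _ _ => by positivity)
    _ = 2 ^ (T * m) * (∑ z ∈ Finset.Icc (-(M : ℤ)) M, ((1 : ℝ) / 2) ^ z.natAbs) ^ m := by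
        rw [← Finset.mul_sum, hBx, Finset.sum_prod_piFinset (Finset.Icc (-(M : ℤ)) M)
          (fun _ z => ((1 : ℝ) / 2) ^ z.natAbs)]
        simp
    _ ≤ 2 ^ (T * m) * S ^ m := by
        gcongr
        exact hs.sum_le_tsum _ (fun i _ => by positivity)
    _ = (2 ^ T * S) ^ m := by
        rw [mul_pow, ← Real.rpow_natCast (2 ^ T), ← Real.rpow_mul (by norm_num)]

set_option maxHeartbeats 2000000 in
/-- Suppose that for constants `p ≥ 1`, `ε ∈ (0,1/2)`, `β > 1` and `k ≥ 1`, for every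
sufficiently large `n` there is a lattice `L_n ⊂ ℝ^{d_n}` of rank `n` with
`d_n ≤ n^k`, a target `t_n` and a radius `r_n > 0` with
`N_p(L_n, (1−ε)^{1/p} r_n, t_n) ≥ β^n N_p(L_n, r_n, 0)`.  Then for any constants
`C ≥ 1` and `η ∈ (2ε², 1)` there are constants `γ > 1` and `C† > 0` such that for all
sufficiently large `m` and `d` with `m/C ≤ d ≤ C m`, there exist `r ≥ d^{1/p}`,
`s > 0`, a scaling `α > 0` and a target `t†` such that, with `n† := ⌈C† m⌉`,
`L† := α·L_{n†}` and `r* := γ (r^p + s^p)^{1/p}`,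
`N_p(ℤ^m, r*, 0) (N_p(L†, r*, 0) + (r*/s) D_p(L†, ((r*)^p − d)^{1/p}))
  < 2^{−m} N_p(L†, (r^p − η d)^{1/p}, t†)`. -/
theorem gadget_exists_of_exp_gap
    (p ε β : ℝ) (k : ℕ) (hp : 1 ≤ p) (hε : ε ∈ Set.Ioo (0 : ℝ) (1 / 2)) (hβ : 1 < β)
    (hk : 1 ≤ k)
    (dfun : ℕ → ℕ) (B : (n : ℕ) → Fin n → Fin (dfun n) → ℝ)
    (tfun : (n : ℕ) → Fin (dfun n) → ℝ) (rfun : ℕ → ℝ) (N₀ : ℕ)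
    (hyp : ∀ n : ℕ, N₀ ≤ n →
      dfun n ≤ n ^ k ∧ LinearIndependent ℝ (B n) ∧ 0 < rfun n ∧
        β ^ n * (Ncount p (latticeOf (B n)) (rfun n) 0 : ℝ) ≤
          (Ncount p (latticeOf (B n)) ((1 - ε) ^ (1 / p) * rfun n) (tfun n) : ℝ))
    (C η : ℝ) (hC : 1 ≤ C) (hη : η ∈ Set.Ioo (2 * ε ^ 2) 1) :
    ∃ γ : ℝ, 1 < γ ∧ ∃ Cdag : ℝ, 0 < Cdag ∧ ∃ M₀ : ℕ, ∀ m d : ℕ,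
      M₀ ≤ m → M₀ ≤ d → (m : ℝ) / C ≤ (d : ℝ) → (d : ℝ) ≤ C * (m : ℝ) →
      ∃ r s : ℝ, (d : ℝ) ^ (1 / p) ≤ r ∧ 0 < s ∧
        ∃ α : ℝ, 0 < α ∧ ∃ tdag : Fin (dfun ⌈Cdag * (m : ℝ)⌉₊) → ℝ,
          (NptZ p m (γ * (r ^ p + s ^ p) ^ (1 / p)) : ℝ) *
            ((Ncount p (scaleSet α (latticeOf (B ⌈Cdag * (m : ℝ)⌉₊)))
                (γ * (r ^ p + s ^ p) ^ (1 / p)) 0 : ℝ) +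
              γ * (r ^ p + s ^ p) ^ (1 / p) / s *
                (Dcount p (scaleSet α (latticeOf (B ⌈Cdag * (m : ℝ)⌉₊)))
                  (((γ * (r ^ p + s ^ p) ^ (1 / p)) ^ p - (d : ℝ)) ^ (1 / p)) : ℝ)) <
          (2 : ℝ) ^ (-(m : ℝ)) *
            (Ncount p (scaleSet α (latticeOf (B ⌈Cdag * (m : ℝ)⌉₊)))
              ((r ^ p - η * (d : ℝ)) ^ (1 / p)) tdag : ℝ) := by
  obtain ⟨hε0, hε1⟩ := hε
  obtain ⟨hη0', hη1⟩ := hη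
  have hη0 : 0 < η := lt_of_le_of_lt (by positivity) hη0'
  have hp0 : 0 < p := by linarith
  have hpi : 0 < 1 / p := by positivity
  have hrt : ∀ x : ℝ, 0 ≤ x → (x ^ (1 / p)) ^ p = x := by
    intro x hx
    rw [← Real.rpow_mul hx, one_div_mul_cancel hp0.ne', Real.rpow_one]
  set δ : ℝ := (1 - η) / 2 with hδ
  have hδ0 : 0 < δ := by rw [hδ]; linarith
  have hδ1 : δ < 1 := by rw [hδ]; linarith
  set K : ℝ := 2 ^ p + 1 / ε with hK
  have h2p : (2 : ℝ) ≤ 2 ^ p := by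
    have := Real.rpow_le_rpow_of_exponent_le (x := 2) (by norm_num) hp
    rwa [Real.rpow_one] at this
  have hiε : 0 < 1 / ε := by positivity
  have hK2 : 2 ≤ K := by rw [hK]; linarith
  have hKp : (2 : ℝ) ^ p ≤ K := by rw [hK]; linarith
  have hKε : 1 ≤ ε * K := by
    have : ε * K = ε * 2 ^ p + 1 := by rw [hK]; field_simp
    rw [this]; nlinarith
  have hK1 : 1 ≤ (1 - ε) * K := by nlinarith
  set a : ℕ → ℝ := fun j => (1 - ε) * K - j * δ with ha
  have hex : ∃ j, a j < 1 - η := by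
    obtain ⟨j, hj⟩ := exists_nat_gt (((1 - ε) * K) / δ)
    refine ⟨j, ?_⟩
    rw [div_lt_iff₀ hδ0] at hj
    simp only [ha]; linarith
  classical
  obtain ⟨J, hJ1, hJ2⟩ : ∃ J : ℕ, a (J + 1) < 1 - η ∧ ∀ j ≤ J, 1 - η ≤ a j := by
    have hne : Nat.find hex ≠ 0 := by
      intro h
      have := Nat.find_spec hex
      rw [h] at this
      simp [ha] at this
      linarith
    obtain ⟨J, hJ⟩ := Nat.exists_eq_succ_of_ne_zero hne
    refine ⟨J, ?_, ?_⟩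
    · have := Nat.find_spec hex
      rwa [hJ] at this
    · intro j hj
      have := Nat.find_min hex (m := j) (by omega)
      linarith
  obtain ⟨b, hb0, hb⟩ := NptZ_bound hp (K * C)
  set δ' : ℝ := δ / 4 with hδ'
  have hδ'0 : 0 < δ' := by rw [hδ']; linarith
  set τ : ℝ := δ / (4 * (K + 1)) with hτ
  have hτ0 : 0 < τ := by positivity
  have hτK : τ * (K + 1) = δ / 4 := by rw [hτ]; field_simp
  have hτ1 : τ ≤ 1 := by nlinarith
  set A : ℝ := (K / δ') ^ (1 / p) with hA
  have hA0 : 0 < A := by positivity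
  set Q : ℝ := 2 * b * (1 + A) + 1 with hQ
  have hQ1 : 1 ≤ Q := by
    have : 0 < 2 * b * (1 + A) := by positivity
    linarith
  obtain ⟨e, he⟩ := pow_unbounded_of_one_lt (Q ^ (J + 1)) hβ
  have he0 : e ≠ 0 := by
    rintro rfl
    have := one_le_pow₀ hQ1 (n := J + 1)
    simp at he; linarith
  have he1 : 1 ≤ e := Nat.one_le_iff_ne_zero.mpr he0
  refine ⟨(1 + τ) ^ (1 / p), Real.one_lt_rpow (by linarith) hpi, (e : ℝ), by positivity,
    N₀ + 1, ?_⟩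
  intro m d hm hd hmd hdm
  have hn : e * m ≤ ⌈(e : ℝ) * (m : ℝ)⌉₊ := by
    rw [← Nat.cast_mul, Nat.ceil_natCast]
  generalize ⌈(e : ℝ) * (m : ℝ)⌉₊ = n at hn ⊢
  have hnm : m ≤ n := le_trans (Nat.le_mul_of_pos_left m he1) hn
  obtain ⟨-, hB, hr0, hgap⟩ := hyp n (by omega)
  have hd1 : (1 : ℝ) ≤ d := by exact_mod_cast (by omega : 1 ≤ d)
  have hd0 : (0 : ℝ) < d := by linarith
  have hm0 : m ≠ 0 := by omega
  have hL := goodSet_lattice hp (B n) hB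
  set R : ℝ := (K * d) ^ (1 / p) with hR
  have hR0 : 0 < R := by positivity
  set α : ℝ := R / rfun n with hα
  have hα0 : 0 < α := by positivity
  have hG := goodSet_scale hp hL α hα0
  rw [← Ncount_scale hp _ α hα0 (rfun n) 0, ← Ncount_scale hp _ α hα0 _ (tfun n)] at hgap
  set G := scaleSet α (latticeOf (B n)) with hGdef
  have hαr : α * rfun n = R := by rw [hα]; field_simp
  have hαr' : α * ((1 - ε) ^ (1 / p) * rfun n) = (a 0 * d) ^ (1 / p) := by
    have h1 : a 0 * d = (1 - ε) * (K * d) := by simp [ha]; ring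
    rw [h1, Real.mul_rpow (by linarith) (by positivity), ← hR, ← hαr]; ring
  rw [smul_zero, hαr, hαr'] at hgap
  set Y : ℝ := (Ncount p G R 0 : ℝ) with hY
  have hY1 : 1 ≤ Y := by
    rw [hY]; exact_mod_cast one_le_Ncount hp hG hR0.le
  have hq : 1 ≤ Q ^ m := one_le_pow₀ hQ1
  obtain ⟨j, hjJ, hj1, hj2⟩ := jump_exists (Q ^ m) Y hq (by linarith) J
    (fun j => (Dcount p G ((a j * d) ^ (1 / p)) : ℝ)) (by
      have h1 : (Q ^ m) ^ (J + 1) ≤ β ^ n := by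
        calc (Q ^ m) ^ (J + 1) = (Q ^ (J + 1)) ^ m := by rw [← pow_mul, ← pow_mul, mul_comm]
          _ ≤ (β ^ e) ^ m := by gcongr
          _ = β ^ (e * m) := by rw [pow_mul]
          _ ≤ β ^ n := pow_le_pow_right₀ hβ.le hn
      have h2 : (Ncount p G ((a 0 * d) ^ (1 / p)) (α • tfun n) : ℝ) ≤
          Dcount p G ((a 0 * d) ^ (1 / p)) := by
        exact_mod_cast Ncount_le_Dcount hp hG _ _
      calc (Q ^ m) ^ (J + 1) * Y ≤ β ^ n * Y := by gcongr
        _ ≤ _ := hgap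
        _ ≤ _ := h2) (by
      have h1 : 0 ≤ a (J + 1) := by
        have := hJ2 J le_rfl
        simp only [ha] at this ⊢
        push_cast
        linarith
      have h2 : 2 * (a (J + 1) * d) ^ (1 / p) ≤ R := by
        have h3 : (2 : ℝ) = ((2 : ℝ) ^ p) ^ (1 / p) := by
          rw [← Real.rpow_mul (by norm_num), mul_one_div_cancel hp0.ne', Real.rpow_one]
        calc 2 * (a (J + 1) * d) ^ (1 / p)
            = ((2 : ℝ) ^ p) ^ (1 / p) * (a (J + 1) * d) ^ (1 / p) := by rw [← h3]
          _ = ((2 : ℝ) ^ p * (a (J + 1) * d)) ^ (1 / p) := by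
              rw [Real.mul_rpow (x := (2 : ℝ) ^ p) (by positivity) (by positivity)]
          _ ≤ R := by
              rw [hR]
              apply Real.rpow_le_rpow (by positivity) _ hpi.le
              rw [← mul_assoc]
              gcongr
              nlinarith
      have h3 := (Dcount_le_double hp hG ((a (J + 1) * d) ^ (1 / p))).trans
        (Ncount_mono hG h2 0)
      rw [hY]
      exact_mod_cast h3)
  have haj := hJ2 j hjJ
  have haj0 : a j ≤ (1 - ε) * K := by
    simp only [ha]
    have : 0 ≤ (j : ℝ) * δ := by positivity
    linarith
  have haj1 : a (j + 1) = a j - δ := by simp only [ha]; push_cast; ring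
  have hrp : 0 ≤ (a j + η) * d := by
    have : 0 ≤ a j + η := by linarith
    positivity
  have hsp : 0 ≤ δ' * d := by positivity
  obtain ⟨t, ht⟩ := Dcount_attained hp hG ((a j * d) ^ (1 / p))
  refine ⟨((a j + η) * d) ^ (1 / p), (δ' * d) ^ (1 / p), ?_, by positivity, α, hα0, t, ?_⟩
  · apply Real.rpow_le_rpow hd0.le _ hpi.le
    nlinarith
  rw [hrt _ hrp, hrt _ hsp]
  set W : ℝ := (1 + τ) * ((a j + η) * d + δ' * d) with hW
  have hrs : (1 + τ) ^ (1 / p) * ((a j + η) * d + δ' * d) ^ (1 / p) = W ^ (1 / p) := by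
    rw [hW, Real.mul_rpow (by linarith) (by linarith)]
  have hW0 : 0 ≤ W := by positivity
  have hWd : (d : ℝ) ≤ W := by
    have h1 : (d : ℝ) ≤ (a j + η) * d := by nlinarith
    have h2 : 0 ≤ τ * ((a j + η) * d + δ' * d) := by positivity
    rw [hW]; linarith
  have hajK : a j + η ≤ K + 1 := by nlinarith
  have hWu : W ≤ (a j + η + δ) * d := by
    have h1 : W = ((1 + τ) * (a j + η + δ')) * d := by rw [hW]; ring
    rw [h1]
    gcongr
    have h2 : τ * (a j + η) ≤ τ * (K + 1) := by gcongr
    have h3 : (1 + τ) * δ' ≤ 2 * δ' := by gcongr; linarith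
    linarith
  have hWK : W ≤ K * d := by
    refine hWu.trans ?_
    gcongr
    linarith
  rw [hrs, hrt W hW0]
  have e1 : (a j + η) * d - η * d = a j * d := by ring
  rw [e1, ht]
  set X : ℝ := (Dcount p G ((a j * d) ^ (1 / p)) : ℝ) with hX
  have b1 : (NptZ p m (W ^ (1 / p)) : ℝ) ≤ b ^ m := by
    apply hb m W hW0
    calc W ≤ K * d := hWK
      _ ≤ K * (C * m) := by gcongr
      _ = K * C * m := by ring
  have b2 : (Ncount p G (W ^ (1 / p)) 0 : ℝ) ≤ X / Q ^ m := by
    rw [le_div_iff₀' (by positivity)]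
    refine le_trans ?_ hj2
    gcongr
    rw [hY]
    exact_mod_cast Ncount_mono hG (Real.rpow_le_rpow hW0 hWK hpi.le) 0
  have b3 : (Dcount p G ((W - d) ^ (1 / p)) : ℝ) ≤ X / Q ^ m := by
    rw [le_div_iff₀' (by positivity)]
    refine le_trans ?_ hj1
    gcongr
    apply Dcount_mono hp hG
    apply Real.rpow_le_rpow (by linarith) _ hpi.le
    rw [haj1]
    have : (a j - δ) * d = (a j + η + δ) * d - d := by rw [hδ]; ring
    linarith
  have b4 : W ^ (1 / p) / (δ' * d) ^ (1 / p) ≤ A := by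
    rw [← Real.div_rpow hW0 hsp, hA]
    apply Real.rpow_le_rpow (by positivity) _ hpi.le
    rw [div_le_div_iff₀ (by positivity) hδ'0]
    nlinarith
  have hX0 : 0 < X := lt_of_lt_of_le (by positivity) hj2
  have hfin : (2 * b) ^ m * (1 + A) < Q ^ m := by
    calc (2 * b) ^ m * (1 + A) ≤ (2 * b) ^ m * (1 + A) ^ m := by
          gcongr
          exact le_self_pow₀ (by linarith) hm0
      _ = (2 * b * (1 + A)) ^ m := by rw [← mul_pow]
      _ < Q ^ m := by
          apply pow_lt_pow_left₀ _ (by positivity) hm0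
          linarith
  calc _ ≤ b ^ m * (X / Q ^ m + A * (X / Q ^ m)) := by gcongr
    _ = (2 : ℝ) ^ (-(m : ℝ)) * (((2 * b) ^ m * (1 + A)) * (X / Q ^ m)) := by
        rw [Real.rpow_neg (by norm_num), Real.rpow_natCast, mul_pow]
        field_simp
    _ < (2 : ℝ) ^ (-(m : ℝ)) * (Q ^ m * (X / Q ^ m)) := by gcongr
    _ = _ := by
        congr 1
        field_simp
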